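/- arXiv:2505.24825 — 2 statements merged into one kernel-verified Lean document; each statement's English description precedes it below -/
import Mathlib

section
/- Let t = 1 + xε. Every greedy run with stretch t on the graph G(x,ε) outputs a subgraph G_gr that contains every edge (x_i, y_i) for 1 ≤ i ≤ n and does not contain the edge (x_n, y_1). In particular, w(G_gr) > n > 1/(2x²ε), and w(G_gr) > (1/(8x²ε)) · w_opt, where w_opt is the minimum total weight of a (1+ε)-spanner of G(x,ε). -/
open scoped BigOperators

namespace Paper

variable {V : Type*}

/-- The weight of a walk: the sum of its edge weights, with multiplicity. -/
noncomputable def wWalk (w : V → V → ℝ) {G : SimpleGraph V} {u v : V} (p : G.Walk u v) : ℝ :=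
  (p.darts.map fun d => w d.toProd.1 d.toProd.2).sum

/-- The distance between two vertices: the infimum of the weights of walks
between them, `⊤` if there is none. -/
noncomputable def gdist (G : SimpleGraph V) (w : V → V → ℝ) (u v : V) : EReal :=
  ⨅ p : G.Walk u v, (wWalk w p : EReal)

/-- `H` is a `t`-spanner of `G` with respect to the weights `w`. -/
def IsSpanner (G : SimpleGraph V) (w : V → V → ℝ) (H : SimpleGraph V) (t : ℝ) : Prop :=
  H ≤ G ∧ ∀ u v : V, gdist H w u v ≤ (t : EReal) * gdist G w u v

/-- The total weight of the edges of a graph. -/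
noncomputable def wGraph (G : SimpleGraph V) (w : V → V → ℝ)
    (hw : ∀ a b, w a b = w b a) : ℝ :=
  ∑ᶠ e ∈ G.edgeSet, Sym2.lift ⟨w, hw⟩ e

/-- Vertices of the hard instance `G(x,ε)`: `Sum.inl ()` is `z`,
`Sum.inr (Sum.inl i)` is `x_{i+1}`, and `Sum.inr (Sum.inr i)` is `y_{i+1}`. -/
abbrev GrV (n : ℕ) := Unit ⊕ Fin n ⊕ Fin n

/-- The weight `W₀ = 1 + ε - (n-1)xε` of the edge `(x_n, y_1)`. -/
noncomputable def W0 (n : ℕ) (x ε : ℝ) : ℝ := 1 + ε - ((n : ℝ) - 1) * (x * ε)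

/-- Base relation of `G(x,ε)`: rungs `(x_i, y_i)`, path edges `(x_i, x_{i+1})`,
`(y_i, y_{i+1})`, the edge `(x_n, y_1)`, and the edges `(x_n, z)`, `(z, y_1)`. -/
def grRel (n : ℕ) : GrV n → GrV n → Prop
  | Sum.inr (Sum.inl i), Sum.inr (Sum.inr j) => i = j ∨ (i.val = n - 1 ∧ j.val = 0)
  | Sum.inr (Sum.inl i), Sum.inr (Sum.inl j) => j.val = i.val + 1
  | Sum.inr (Sum.inr i), Sum.inr (Sum.inr j) => j.val = i.val + 1
  | Sum.inl _, Sum.inr (Sum.inl i) => i.val = n - 1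
  | Sum.inl _, Sum.inr (Sum.inr j) => j.val = 0
  | _, _ => False

/-- The hard instance `G(x,ε)` for the greedy algorithm. -/
def grG (n : ℕ) : SimpleGraph (GrV n) := SimpleGraph.fromRel (grRel n)

/-- The edge weights of `G(x,ε)`. -/
noncomputable def grW (n : ℕ) (x ε : ℝ) : GrV n → GrV n → ℝ
  | Sum.inr (Sum.inl i), Sum.inr (Sum.inr j) => if i = j then 1 else W0 n x ε
  | Sum.inr (Sum.inr j), Sum.inr (Sum.inl i) => if i = j then 1 else W0 n x ε
  | Sum.inl _, _ => (1 + x * ε) * W0 n x ε / 2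
  | _, Sum.inl _ => (1 + x * ε) * W0 n x ε / 2
  | _, _ => x * ε

lemma grW_symm (n : ℕ) (x ε : ℝ) : ∀ a b : GrV n, grW n x ε a b = grW n x ε b a := by
  rintro (⟨⟩ | a | a) (⟨⟩ | b | b) <;> rfl

open scoped Classical in
/-- One run of the greedy algorithm with stretch `t`: process the pairs in the list in
order, starting from `H`, adding the pair `(u,v)` as an edge iff the distance between
`u` and `v` in the current subgraph exceeds `t · w(u,v)`. -/
noncomputable def greedy (w : V → V → ℝ) (t : ℝ) : List (V × V) → SimpleGraph V → SimpleGraph V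
  | [], H => H
  | e :: L, H =>
      greedy w t L
        (if ((t * w e.1 e.2 : ℝ) : EReal) < gdist H w e.1 e.2
          then H ⊔ SimpleGraph.fromEdgeSet {s(e.1, e.2)} else H)


lemma wWalk_nil {V : Type*} (w : V → V → ℝ) (G : SimpleGraph V) (u : V) :
    wWalk w (SimpleGraph.Walk.nil : G.Walk u u) = 0 := by
  simp [wWalk]

lemma wWalk_cons {V : Type*} (w : V → V → ℝ) {G : SimpleGraph V} {u v z : V} (h : G.Adj u v)
    (p : G.Walk v z) : wWalk w (SimpleGraph.Walk.cons h p) = w u v + wWalk w p := by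
  simp [wWalk]

lemma wWalk_append {V : Type*} (w : V → V → ℝ) {G : SimpleGraph V} {u v z : V} (p : G.Walk u v)
    (q : G.Walk v z) : wWalk w (p.append q) = wWalk w p + wWalk w q := by
  simp [wWalk]

lemma wWalk_reverse {V : Type*} (w : V → V → ℝ) (hw : ∀ a b, w a b = w b a)
    {G : SimpleGraph V} {u v : V} (p : G.Walk u v) : wWalk w p.reverse = wWalk w p := by
  induction p with
  | nil => simp [wWalk_nil]
  | cons h p ih =>
    rw [SimpleGraph.Walk.reverse_cons, wWalk_append, ih, wWalk_cons, wWalk_cons, wWalk_nil, hw]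
    ring

/-- There is a walk of weight at most `c`. -/
def Reach {V : Type*} (H : SimpleGraph V) (w : V → V → ℝ) (u v : V) (c : ℝ) : Prop :=
  ∃ p : H.Walk u v, wWalk w p ≤ c

section
variable {H : SimpleGraph V} {w : V → V → ℝ}

lemma Reach.refl (u : V) : Reach H w u u 0 := ⟨.nil, (wWalk_nil _ _ _).le⟩

lemma Reach.trans {a b c : V} {r s : ℝ} (h1 : Reach H w a b r) (h2 : Reach H w b c s) :
    Reach H w a c (r + s) := by
  obtain ⟨p, hp⟩ := h1
  obtain ⟨q, hq⟩ := h2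
  exact ⟨p.append q, by rw [wWalk_append]; linarith⟩

lemma Reach.symm (hw : ∀ a b, w a b = w b a) {a b : V} {r : ℝ} (h1 : Reach H w a b r) :
    Reach H w b a r := by
  obtain ⟨p, hp⟩ := h1
  exact ⟨p.reverse, by rw [wWalk_reverse w hw]; exact hp⟩

lemma Reach.adj {a b : V} (h : H.Adj a b) : Reach H w a b (w a b) :=
  ⟨.cons h .nil, by rw [wWalk_cons, wWalk_nil]; simp⟩

lemma Reach.mono {a b : V} {r s : ℝ} (h : Reach H w a b r) (hrs : r ≤ s) : Reach H w a b s := by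
  obtain ⟨p, hp⟩ := h
  exact ⟨p, hp.trans hrs⟩

lemma Reach.gdist_le {a b : V} {r : ℝ} (h : Reach H w a b r) : gdist H w a b ≤ (r : EReal) := by
  obtain ⟨p, hp⟩ := h
  exact (iInf_le _ p).trans (EReal.coe_le_coe_iff.2 hp)

lemma gdist_symm (hw : ∀ a b, w a b = w b a) (a b : V) : gdist H w a b = gdist H w b a := by
  apply le_antisymm
  · refine le_iInf fun p => ?_
    exact Reach.gdist_le (Reach.symm hw ⟨p, le_rfl⟩)
  · refine le_iInf fun p => ?_
    exact Reach.gdist_le (Reach.symm hw ⟨p, le_rfl⟩)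

lemma potential (φ : V → ℝ) (h : ∀ a b, H.Adj a b → φ b ≤ φ a + w a b) {u v : V}
    (p : H.Walk u v) : φ v ≤ φ u + wWalk w p := by
  induction p with
  | nil => simp [wWalk_nil]
  | cons hadj p ih =>
    rw [wWalk_cons]
    have := h _ _ hadj
    linarith

lemma potential_lt (φ : V → ℝ) (h : ∀ a b, H.Adj a b → φ b ≤ φ a + w a b) {u v : V} {c : ℝ}
    (hc : c < φ v - φ u) : (c : EReal) < gdist H w u v := by
  refine lt_of_lt_of_le (EReal.coe_lt_coe_iff.2 hc) (le_iInf fun p => ?_)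
  have := potential φ h p
  exact EReal.coe_le_coe_iff.2 (by linarith)

lemma spanner_of_edges {G : SimpleGraph V} (hH : H ≤ G) {t : ℝ} (ht : 0 < t)
    (h : ∀ a b, G.Adj a b → Reach H w a b (t * w a b)) : IsSpanner G w H t := by
  refine ⟨hH, fun u v => ?_⟩
  have key : ∀ p : G.Walk u v, Reach H w u v (t * wWalk w p) := by
    intro p
    induction p with
    | nil => rw [wWalk_nil, mul_zero]; exact Reach.refl _
    | cons hadj p ih =>
      rw [wWalk_cons, mul_add]
      exact (h _ _ hadj).trans ih
  have ht' : (0 : EReal) < (t : EReal) := by exact_mod_cast ht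
  rw [← EReal.div_le_iff_le_mul ht' (EReal.coe_ne_top t)]
  refine le_iInf fun p => ?_
  rw [EReal.div_le_iff_le_mul ht' (EReal.coe_ne_top t)]
  have := (key p).gdist_le
  exact_mod_cast this

lemma greedy_append (t : ℝ) (L1 L2 : List (V × V)) (H : SimpleGraph V) :
    greedy w t (L1 ++ L2) H = greedy w t L2 (greedy w t L1 H) := by
  induction L1 generalizing H with
  | nil => rfl
  | cons e L ih => simp only [List.cons_append, greedy]; exact ih _

lemma le_greedy (t : ℝ) (L : List (V × V)) (H : SimpleGraph V) : H ≤ greedy w t L H := by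
  induction L generalizing H with
  | nil => exact le_rfl
  | cons e L ih =>
    simp only [greedy]
    refine le_trans ?_ (ih _)
    split_ifs
    · exact le_sup_left
    · exact le_rfl

lemma greedy_adj_or (t : ℝ) (L : List (V × V)) (H : SimpleGraph V) {c d : V}
    (h : (greedy w t L H).Adj c d) : H.Adj c d ∨ s(c, d) ∈ L.map fun p => s(p.1, p.2) := by
  induction L generalizing H with
  | nil => exact Or.inl h
  | cons e L ih =>
    simp only [greedy] at h
    rcases ih _ h with h | h
    · split_ifs at h
      · rw [SimpleGraph.sup_adj, SimpleGraph.fromEdgeSet_adj] at h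
        rcases h with h | h
        · exact Or.inl h
        · right
          have := h.1
          rw [Set.mem_singleton_iff] at this
          simp [this]
      · exact Or.inl h
    · right
      rw [List.map_cons]
      exact List.mem_cons_of_mem _ h

lemma sym2_w {α : Type*} {w : V → V → α} (hw : ∀ a b, w a b = w b a) {a b c d : V} (h : s(a, b) = s(c, d)) :
    w a b = w c d := by
  rw [Sym2.eq_iff] at h
  rcases h with ⟨rfl, rfl⟩ | ⟨rfl, rfl⟩
  · rfl
  · exact hw _ _

/-- The state of a greedy run just before the edge `(a,b)` is processed. -/
lemma greedy_state {G : SimpleGraph V} (hw : ∀ a b, w a b = w b a) (t : ℝ) (L : List (V × V))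
    (hnodup : (L.map fun p => s(p.1, p.2)).Nodup)
    (hcover : ∀ e : Sym2 V, e ∈ G.edgeSet ↔ e ∈ L.map fun p => s(p.1, p.2))
    (hsorted : L.Pairwise fun p q => w p.1 p.2 ≤ w q.1 q.2) {a b : V} (hab : G.Adj a b) :
    ∃ H1 : SimpleGraph V,
      ((greedy w t L ⊥).Adj a b ↔ ((t * w a b : ℝ) : EReal) < gdist H1 w a b) ∧
      (∀ c d, H1.Adj c d → s(c, d) ≠ s(a, b) ∧ G.Adj c d ∧ w c d ≤ w a b ∧
        (greedy w t L ⊥).Adj c d) ∧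
      (∀ c d, w c d < w a b → (greedy w t L ⊥).Adj c d → H1.Adj c d) := by
  have hmem := (hcover s(a, b)).1 hab
  rw [List.mem_map] at hmem
  obtain ⟨p, hpL, hp⟩ := hmem
  obtain ⟨L1, L2, rfl⟩ := List.append_of_mem hpL
  rw [List.map_append, List.map_cons, List.nodup_append] at hnodup
  obtain ⟨-, hn2, hn3⟩ := hnodup
  rw [List.nodup_cons] at hn2
  rw [List.pairwise_append, List.pairwise_cons] at hsorted
  obtain ⟨-, ⟨hs2, -⟩, hs3⟩ := hsorted
  have hwp : w p.1 p.2 = w a b := sym2_w hw hp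
  have hdp : ∀ H : SimpleGraph V, gdist H w p.1 p.2 = gdist H w a b := fun H =>
    sym2_w (w := gdist H w) (gdist_symm hw) hp
  refine ⟨greedy w t L1 ⊥, ?_, ?_, ?_⟩
  · rw [greedy_append]
    simp only [greedy]
    rw [hwp, hdp]
    constructor
    · intro h
      by_contra hlt
      rw [if_neg hlt] at h
      rcases greedy_adj_or _ _ _ h with h | h
      · rcases greedy_adj_or _ _ _ h with h | h
        · exact h
        · exact hn3 _ h _ List.mem_cons_self hp.symm
      · exact hn2.1 (hp ▸ h)
    · intro h
      rw [if_pos h]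
      refine le_greedy _ _ _ ?_
      rw [SimpleGraph.sup_adj, SimpleGraph.fromEdgeSet_adj]
      exact Or.inr ⟨hp.symm, hab.ne⟩
  · intro c d hcd
    have hm : s(c, d) ∈ L1.map fun p => s(p.1, p.2) := by
      rcases greedy_adj_or _ _ _ hcd with h | h
      · exact h.elim
      · exact h
    refine ⟨?_, ?_, ?_, ?_⟩
    · rw [← hp]
      exact hn3 _ hm _ List.mem_cons_self
    · have := (hcover s(c, d)).2 (by rw [List.map_append]; exact List.mem_append_left _ hm)
      exact this
    · obtain ⟨q, hq, hq2⟩ := List.mem_map.1 hm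
      rw [← hwp, ← sym2_w hw hq2]
      exact hs3 _ hq _ List.mem_cons_self
    · rw [greedy_append]
      exact le_greedy _ _ _ hcd
  · intro c d hlt hcd
    rw [greedy_append] at hcd
    rcases greedy_adj_or _ _ _ hcd with h | h
    · exact h
    · exfalso
      obtain ⟨q, hq, hq2⟩ := List.mem_map.1 h
      have h1 : w p.1 p.2 ≤ w q.1 q.2 := by
        rcases List.mem_cons.1 hq with rfl | hq
        · exact le_rfl
        · exact hs2 _ hq
      rw [sym2_w hw hq2, hwp] at h1
      linarith
end

/-- The numerical facts about the parameters. -/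
lemma numeric (x ε : ℝ) (hε0 : 0 < ε) 
    (hx1 : 1 ≤ x) (hx2 : x ≤ (1/2) * Real.sqrt (1/ε))
    (n : ℕ) (hn : (n : ℤ) = 1 + ⌈1/x + 1/(2 * x^2 * ε)⌉) :
    0 < x * ε ∧ x * ε ≤ 1/4 ∧ 0 < W0 n x ε ∧ W0 n x ε < 1 ∧
      x * ε * (1 - W0 n x ε) < ε ∧ ((n : ℝ) - 1) * (x * ε) ≤ 1 ∧
      1 / (2 * x^2 * ε) < (n : ℝ) ∧ 2 ≤ n := by
  have hx0 : 0 < x := by linarith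
  have hsq : 4 * (x ^ 2 * ε) ≤ 1 := by
    have h1 : (2 * x) ^ 2 ≤ (Real.sqrt (1/ε)) ^ 2 := by
      apply pow_le_pow_left₀ <;> linarith
    rw [Real.sq_sqrt (by positivity)] at h1
    rw [le_div_iff₀ hε0] at h1
    linarith
  have hnR : (n : ℝ) - 1 = (⌈1/x + 1/(2 * x^2 * ε)⌉ : ℝ) := by
    have : (n : ℝ) = 1 + (⌈1/x + 1/(2 * x^2 * ε)⌉ : ℝ) := by exact_mod_cast hn
    linarith
  have hlo : 1/x + 1/(2 * x^2 * ε) ≤ (n : ℝ) - 1 := by rw [hnR]; exact Int.le_ceil _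
  have hhi : (n : ℝ) - 1 < 1/x + 1/(2 * x^2 * ε) + 1 := by rw [hnR]; exact Int.ceil_lt_add_one _
  have hr0 : 0 < 1/x := by positivity
  have hr1 : 1/x ≤ 1 := by rw [div_le_one hx0]; exact hx1
  have hq0 : 0 < 1/(2 * x^2 * ε) := by positivity
  have hδ0 : 0 < x * ε := by positivity
  have hid : (1/x + 1/(2 * x^2 * ε)) * (x * ε) = ε + (1/x)/2 := by field_simp
  have hδr : x * ε * (1/x) = ε := by field_simp
  have hδ : x * ε ≤ (1/x)/4 := by
    rw [div_div, le_div_iff₀ (by positivity)]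
    linarith
  have hlo' := mul_le_mul_of_nonneg_right hlo hδ0.le
  have hhi' := mul_lt_mul_of_pos_right hhi hδ0
  rw [add_mul _ 1, hid] at hhi'
  rw [hid] at hlo'
  have hW : W0 n x ε = 1 + ε - ((n : ℝ) - 1) * (x * ε) := rfl
  have hWlo : 1 - W0 n x ε < 3/4 * (1/x) := by linarith
  have hεδ : ε ≤ x * ε := by nlinarith
  refine ⟨hδ0, by linarith, by linarith, by linarith, ?_, by linarith, by linarith, ?_⟩
  · nlinarith
  · have : (1 : ℝ) < n := by linarith
    exact_mod_cast this

/-- The greedy run, given the numerical facts. -/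
lemma run_facts (x ε : ℝ) (n : ℕ) (hδ0 : 0 < x * ε) (hδ1 : x * ε ≤ 1/4) (hW0 : 0 < W0 n x ε)
    (hW1 : W0 n x ε < 1) (hWx : x * ε * (1 - W0 n x ε) < ε) (hm : ((n : ℝ) - 1) * (x * ε) ≤ 1)
    (hn2 : 2 ≤ n) (L : List (GrV n × GrV n))
    (hnodup : (L.map fun p => s(p.1, p.2)).Nodup)
    (hcover : ∀ e : Sym2 (GrV n), e ∈ (grG n).edgeSet ↔ e ∈ L.map fun p => s(p.1, p.2))
    (hsorted : L.Pairwise fun p q => grW n x ε p.1 p.2 ≤ grW n x ε q.1 q.2) :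
    (∀ i : Fin n, (greedy (grW n x ε) (1 + x * ε) L ⊥).Adj
        (Sum.inr (Sum.inl i)) (Sum.inr (Sum.inr i))) ∧
    (∀ a b : Fin n, a.val = n - 1 → b.val = 0 →
      ¬ (greedy (grW n x ε) (1 + x * ε) L ⊥).Adj (Sum.inr (Sum.inl a)) (Sum.inr (Sum.inr b))) ∧
    (∀ a : Fin n, a.val = n - 1 →
      (greedy (grW n x ε) (1 + x * ε) L ⊥).Adj (Sum.inl ()) (Sum.inr (Sum.inl a))) := by
  have hw := grW_symm n x ε
  have htW : (1 + x * ε) * W0 n x ε / 2 < W0 n x ε := by nlinarith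
  have htW0 : 0 < (1 + x * ε) * W0 n x ε / 2 := by positivity
  have htt : (1 + x * ε) * ((1 + x * ε) * W0 n x ε / 2) < 100 := by nlinarith
  have hX : ∀ a : Fin n, a.val = n - 1 →
      (greedy (grW n x ε) (1 + x * ε) L ⊥).Adj (Sum.inl ()) (Sum.inr (Sum.inl a)) := by
    intro a ha
    have hadj : (grG n).Adj (Sum.inl ()) (Sum.inr (Sum.inl a)) := by
      simp [grG, SimpleGraph.fromRel_adj, grRel, ha]
    obtain ⟨H1, h1, h2, -⟩ := greedy_state hw (1 + x * ε) L hnodup hcover hsorted hadj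
    rw [h1]
    let φ : GrV n → ℝ := fun v => match v with
      | Sum.inl _ => 0
      | Sum.inr (Sum.inl _) => 100
      | Sum.inr (Sum.inr _) => 0
    refine potential_lt φ ?_ (by simpa [φ, grW] using htt)
    intro c d hcd
    obtain ⟨hne, hG, hle, -⟩ := h2 c d hcd
    rcases c with ⟨⟩ | c | c <;> rcases d with ⟨⟩ | d | d <;>
      simp [grG, SimpleGraph.fromRel_adj, grRel, grW, φ] at hne hG hle ⊢
    all_goals first
      | linarith
      | (exfalso; exact hne (Fin.ext (by omega)))
      | (exfalso; split_ifs at hle <;> linarith)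
  have hY : ∀ b : Fin n, b.val = 0 →
      (greedy (grW n x ε) (1 + x * ε) L ⊥).Adj (Sum.inl ()) (Sum.inr (Sum.inr b)) := by
    intro a ha
    have hadj : (grG n).Adj (Sum.inl ()) (Sum.inr (Sum.inr a)) := by
      simp [grG, SimpleGraph.fromRel_adj, grRel, ha]
    obtain ⟨H1, h1, h2, -⟩ := greedy_state hw (1 + x * ε) L hnodup hcover hsorted hadj
    rw [h1]
    let φ : GrV n → ℝ := fun v => match v with
      | Sum.inl _ => 0
      | Sum.inr (Sum.inr _) => 100
      | Sum.inr (Sum.inl _) => 0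
    refine potential_lt φ ?_ (by simpa [φ, grW] using htt)
    intro c d hcd
    obtain ⟨hne, hG, hle, -⟩ := h2 c d hcd
    rcases c with ⟨⟩ | c | c <;> rcases d with ⟨⟩ | d | d <;>
      simp [grG, SimpleGraph.fromRel_adj, grRel, grW, φ] at hne hG hle ⊢
    all_goals first
      | linarith
      | (exfalso; exact hne (Fin.ext (by omega)))
      | (exfalso; split_ifs at hle <;> linarith)
  have hXY : ∀ a b : Fin n, a.val = n - 1 → b.val = 0 →
      ¬ (greedy (grW n x ε) (1 + x * ε) L ⊥).Adj (Sum.inr (Sum.inl a)) (Sum.inr (Sum.inr b)) := by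
    intro a b ha hb
    have hab : a ≠ b := fun h => by rw [h] at ha; omega
    have hadj : (grG n).Adj (Sum.inr (Sum.inl a)) (Sum.inr (Sum.inr b)) := by
      simp [grG, SimpleGraph.fromRel_adj, grRel, ha, hb]
    obtain ⟨H1, h1, -, h3⟩ := greedy_state hw (1 + x * ε) L hnodup hcover hsorted hadj
    rw [h1, not_lt]
    have e1 : H1.Adj (Sum.inl ()) (Sum.inr (Sum.inl a)) :=
      h3 _ _ (by simpa [grW, hab] using htW) (hX a ha)
    have e2 : H1.Adj (Sum.inl ()) (Sum.inr (Sum.inr b)) :=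
      h3 _ _ (by simpa [grW, hab] using htW) (hY b hb)
    refine Reach.gdist_le (((Reach.adj e1).symm hw).trans (Reach.adj e2) |>.mono ?_)
    simp only [grW, if_neg hab]
    linarith
  refine ⟨?_, hXY, hX⟩
  intro i
  have hadj : (grG n).Adj (Sum.inr (Sum.inl i)) (Sum.inr (Sum.inr i)) := by
    simp [grG, SimpleGraph.fromRel_adj, grRel]
  obtain ⟨H1, h1, h2, -⟩ := greedy_state hw (1 + x * ε) L hnodup hcover hsorted hadj
  rw [h1]
  have hW : W0 n x ε = 1 + ε - ((n : ℝ) - 1) * (x * ε) := rfl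
  obtain ⟨T, hT1, hT2, hT3⟩ : ∃ T : ℝ, 1 + x * ε < T ∧ T ≤ 1 + 2 * (x * ε) ∧
      T ≤ 1 + ε + x * ε * W0 n x ε :=
    ⟨min (1 + 2 * (x * ε)) (1 + ε + x * ε * W0 n x ε), lt_min (by linarith) (by linarith),
      min_le_left _ _, min_le_right _ _⟩
  let φ : GrV n → ℝ := fun v => match v with
      | Sum.inl _ => (((n : ℝ) - 1 - i.val) * (x * ε) + (T - (i.val : ℝ) * (x * ε))) / 2
      | Sum.inr (Sum.inl j) => |(j.val : ℝ) - i.val| * (x * ε)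
      | Sum.inr (Sum.inr j) => T - |(j.val : ℝ) - i.val| * (x * ε)
  refine potential_lt φ ?_ (by simpa [φ, grW] using hT1)
  have habs : ∀ j : Fin n, j ≠ i → x * ε ≤ |(j.val : ℝ) - i.val| * (x * ε) := by
    intro j hj
    have : (1 : ℝ) ≤ |(j.val : ℝ) - i.val| := by
      have h : (1 : ℤ) ≤ |(j.val : ℤ) - i.val| := by
        apply Int.one_le_abs
        intro h
        exact hj (Fin.ext (by omega))
      exact_mod_cast h
    nlinarith
  have habs2 : ∀ j : Fin n, |(j.val : ℝ) - i.val| * (x * ε) ≤ 1 := by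
    intro j
    have : |(j.val : ℝ) - i.val| ≤ (n : ℝ) - 1 := by
      have h1 : (j.val : ℝ) + 1 ≤ n := by exact_mod_cast j.2
      have h2 : (i.val : ℝ) + 1 ≤ n := by exact_mod_cast i.2
      have h3 : (0 : ℝ) ≤ j.val := by positivity
      have h4 : (0 : ℝ) ≤ i.val := by positivity
      rw [abs_le]
      constructor <;> linarith
    nlinarith
  have hstep : ∀ c d : Fin n, (d.val = c.val + 1 ∨ c.val = d.val + 1) →
      |(d.val : ℝ) - i.val| * (x * ε) ≤ |(c.val : ℝ) - i.val| * (x * ε) + x * ε := by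
    intro c d h
    have : |(d.val : ℝ) - i.val| ≤ |(c.val : ℝ) - i.val| + 1 := by
      have h1 : |(d.val : ℝ) - i.val| ≤ |(d.val : ℝ) - c.val| + |(c.val : ℝ) - i.val| :=
        abs_sub_le _ _ _
      have h2 : |(d.val : ℝ) - c.val| = 1 := by
        rcases h with h | h <;> rw [h] <;> push_cast <;> simp
      linarith
    nlinarith
  have hlast : ∀ c : Fin n, c.val = n - 1 → |(c.val : ℝ) - i.val| = (n : ℝ) - 1 - i.val := by
    intro c hc
    have h2 : (i.val : ℝ) + 1 ≤ n := by exact_mod_cast i.2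
    rw [hc, Nat.cast_sub (by omega), Nat.cast_one]
    exact abs_of_nonneg (by linarith)
  have hfirst : ∀ c : Fin n, c.val = 0 → |(c.val : ℝ) - i.val| = (i.val : ℝ) := by
    intro c hc
    rw [hc]
    simp
  have hrung : ∀ c d : Fin n, H1.Adj (Sum.inr (Sum.inl c)) (Sum.inr (Sum.inr d)) →
      c = d ∧ c ≠ i := by
    intro c d h
    obtain ⟨hne, hG, -, hfin⟩ := h2 _ _ h
    have h4 := hXY c d
    simp [grG, SimpleGraph.fromRel_adj, grRel] at hne hG
    rcases hG with hG | hG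
    · exact ⟨hG, fun h => hne h (hG ▸ h)⟩
    · exact absurd hfin (h4 hG.1 hG.2)
  intro c d hcd
  obtain ⟨-, hG, -, -⟩ := h2 c d hcd
  rcases c with ⟨⟩ | c | c <;> rcases d with ⟨⟩ | d | d <;>
    simp only [grG, SimpleGraph.fromRel_adj, grRel, or_false, false_or, ne_eq, reduceCtorEq,
      not_false_eq_true, true_and, or_self, not_true_eq_false, and_false, and_true] at hG
  · rw [show φ (Sum.inl ()) = _ from rfl, show φ (Sum.inr (Sum.inl d)) = _ from rfl]
    simp only [φ, grW]
    rw [hlast d hG]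
    nlinarith
  · simp only [φ, grW]
    rw [hfirst d hG]
    nlinarith
  · simp only [φ, grW]
    rw [hlast c hG]
    nlinarith
  · simp only [φ, grW]
    exact hstep c d hG.2
  · obtain ⟨rfl, hc⟩ := hrung c d hcd
    have := habs c hc
    simp only [φ, grW, if_true]
    linarith
  · simp only [φ, grW]
    rw [hfirst c hG]
    nlinarith
  · obtain ⟨rfl, hc⟩ := hrung d c hcd.symm
    have := habs2 d
    simp only [φ, grW, if_true]
    linarith
  · simp only [φ, grW]
    have := hstep d c hG.2.symm
    linarith

lemma lift_nonneg {n : ℕ} {x ε : ℝ} (h : ∀ a b, 0 ≤ grW n x ε a b) (e : Sym2 (GrV n)) :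
    0 ≤ Sym2.lift ⟨grW n x ε, grW_symm n x ε⟩ e := by
  induction e with
  | _ a b => exact h a b

open scoped Classical in
lemma wGraph_eq {n : ℕ} (x ε : ℝ) (G : SimpleGraph (GrV n)) :
    wGraph G (grW n x ε) (grW_symm n x ε) =
      ∑ e ∈ G.edgeFinset, Sym2.lift ⟨grW n x ε, grW_symm n x ε⟩ e := by
  unfold wGraph
  rw [← finsum_mem_coe_finset]
  simp

/-- Relation of the good spanner: everything but the rungs. -/
def hRel (n : ℕ) : GrV n → GrV n → Prop
  | Sum.inr (Sum.inl i), Sum.inr (Sum.inr j) => i.val = n - 1 ∧ j.val = 0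
  | Sum.inr (Sum.inl i), Sum.inr (Sum.inl j) => j.val = i.val + 1
  | Sum.inr (Sum.inr i), Sum.inr (Sum.inr j) => j.val = i.val + 1
  | Sum.inl _, Sum.inr (Sum.inl i) => i.val = n - 1
  | Sum.inl _, Sum.inr (Sum.inr j) => j.val = 0
  | _, _ => False

/-- The good spanner. -/
def hG (n : ℕ) : SimpleGraph (GrV n) := SimpleGraph.fromRel (hRel n)

lemma hG_spanner (x ε : ℝ) (n : ℕ) (hε0 : 0 < ε) (hn2 : 2 ≤ n)
    (hpos : ∀ a b, 0 ≤ grW n x ε a b) : IsSpanner (grG n) (grW n x ε) (hG n) (1 + ε) := by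
  have hw := grW_symm n x ε
  have hXs : ∀ k : ℕ, ∀ i j : Fin n, j.val = i.val + k →
      Reach (hG n) (grW n x ε) (Sum.inr (Sum.inl i)) (Sum.inr (Sum.inl j)) (k * (x * ε)) := by
    intro k
    induction k with
    | zero =>
      intro i j h
      obtain rfl : j = i := Fin.ext h
      simpa using Reach.refl _
    | succ k ih =>
      intro i j h
      have h1 := ih i ⟨i.val + k, by omega⟩ rfl
      have h2 : (hG n).Adj (Sum.inr (Sum.inl ⟨i.val + k, by omega⟩)) (Sum.inr (Sum.inl j)) := by
        simp only [hG, SimpleGraph.fromRel_adj, hRel]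
        refine ⟨fun h => ?_, Or.inl (by omega)⟩
        simp only [Sum.inr.injEq, Sum.inl.injEq] at h
        have := congrArg Fin.val h
        simp only at this
        omega
      refine (h1.trans (Reach.adj h2)).mono ?_
      simp only [grW]
      push_cast
      linarith
  have hYs : ∀ k : ℕ, ∀ i j : Fin n, j.val = i.val + k →
      Reach (hG n) (grW n x ε) (Sum.inr (Sum.inr i)) (Sum.inr (Sum.inr j)) (k * (x * ε)) := by
    intro k
    induction k with
    | zero =>
      intro i j h
      obtain rfl : j = i := Fin.ext h
      simpa using Reach.refl _
    | succ k ih =>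
      intro i j h
      have h1 := ih i ⟨i.val + k, by omega⟩ rfl
      have h2 : (hG n).Adj (Sum.inr (Sum.inr ⟨i.val + k, by omega⟩)) (Sum.inr (Sum.inr j)) := by
        simp only [hG, SimpleGraph.fromRel_adj, hRel]
        refine ⟨fun h => ?_, Or.inl (by omega)⟩
        simp only [Sum.inr.injEq] at h
        have := congrArg Fin.val h
        simp only at this
        omega
      refine (h1.trans (Reach.adj h2)).mono ?_
      simp only [grW]
      push_cast
      linarith
  have hr : ∀ i : Fin n, Reach (hG n) (grW n x ε) (Sum.inr (Sum.inl i)) (Sum.inr (Sum.inr i))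
      (1 + ε) := by
    intro i
    have h1 := hXs (n - 1 - i.val) i ⟨n - 1, by omega⟩ (by simp only; omega)
    have h3 := hYs i.val ⟨0, by omega⟩ i (by simp)
    have h2 : (hG n).Adj (Sum.inr (Sum.inl ⟨n - 1, by omega⟩)) (Sum.inr (Sum.inr ⟨0, by omega⟩)) := by
      simp [hG, SimpleGraph.fromRel_adj, hRel]
    refine ((h1.trans (Reach.adj h2)).trans h3).mono ?_
    have hne : (⟨n - 1, by omega⟩ : Fin n) ≠ ⟨0, by omega⟩ := by
      intro h
      have := congrArg Fin.val h
      simp only at this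
      omega
    simp only [grW, if_neg hne, W0]
    have hc : ((n - 1 - i.val : ℕ) : ℝ) = (n : ℝ) - 1 - i.val := by
      rw [Nat.cast_sub (by omega), Nat.cast_sub (by omega), Nat.cast_one]
    rw [hc]
    apply le_of_eq
    ring
  have hadj : ∀ a b, (hG n).Adj a b → Reach (hG n) (grW n x ε) a b ((1 + ε) * grW n x ε a b) := by
    intro a b h
    refine (Reach.adj h).mono ?_
    have := hpos a b
    nlinarith
  apply spanner_of_edges _ (by linarith)
  · intro a b h
    rcases a with ⟨⟩ | a | a <;> rcases b with ⟨⟩ | b | b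
    case inr.inl.inr.inr =>
      by_cases hab : a = b
      · subst hab
        simpa [grW] using hr a
      · apply hadj
        simpa [grG, hG, hRel, grRel, SimpleGraph.fromRel_adj, hab] using h
    case inr.inr.inr.inl =>
      by_cases hab : b = a
      · subst hab
        simpa [grW] using (hr b).symm hw
      · apply hadj
        simpa [grG, hG, hRel, grRel, SimpleGraph.fromRel_adj, hab] using h
    all_goals
      apply hadj
      simpa [grG, hG, hRel, grRel, SimpleGraph.fromRel_adj] using h
  · intro a b h
    rcases a with ⟨⟩ | a | a <;> rcases b with ⟨⟩ | b | b <;>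
      simp only [grG, hG, hRel, grRel, SimpleGraph.fromRel_adj] at h ⊢ <;> tauto

/-- Parametrization of the edges of the good spanner. -/
def hEdge (n : ℕ) (hn2 : 2 ≤ n) : (Fin (n - 1) ⊕ Fin (n - 1)) ⊕ Fin 3 → Sym2 (GrV n)
  | Sum.inl (Sum.inl i) => s(Sum.inr (Sum.inl ⟨i.val, by omega⟩), Sum.inr (Sum.inl ⟨i.val + 1, by omega⟩))
  | Sum.inl (Sum.inr i) => s(Sum.inr (Sum.inr ⟨i.val, by omega⟩), Sum.inr (Sum.inr ⟨i.val + 1, by omega⟩))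
  | Sum.inr 0 => s(Sum.inr (Sum.inl ⟨n - 1, by omega⟩), Sum.inr (Sum.inr ⟨0, by omega⟩))
  | Sum.inr 1 => s(Sum.inl (), Sum.inr (Sum.inl ⟨n - 1, by omega⟩))
  | Sum.inr 2 => s(Sum.inl (), Sum.inr (Sum.inr ⟨0, by omega⟩))

lemma hRel_mem (n : ℕ) (hn2 : 2 ≤ n) (a b : GrV n) (h : hRel n a b) :
    ∃ k, hEdge n hn2 k = s(a, b) := by
  rcases a with ⟨⟩ | a | a <;> rcases b with ⟨⟩ | b | b <;> simp only [hRel] at h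
  · refine ⟨Sum.inr 1, ?_⟩
    simp [hEdge, Fin.ext_iff, h]
  · refine ⟨Sum.inr 2, ?_⟩
    simp [hEdge, Fin.ext_iff, h]
  · refine ⟨Sum.inl (Sum.inl ⟨a.val, by omega⟩), ?_⟩
    simp [hEdge, Fin.ext_iff, h]
  · refine ⟨Sum.inr 0, ?_⟩
    simp [hEdge, Fin.ext_iff, h]
  · refine ⟨Sum.inl (Sum.inr ⟨a.val, by omega⟩), ?_⟩
    simp [hEdge, Fin.ext_iff, h]

lemma hG_weight (x ε : ℝ) (n : ℕ) (hn2 : 2 ≤ n) (hpos : ∀ a b, 0 ≤ grW n x ε a b) :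
    wGraph (hG n) (grW n x ε) (grW_symm n x ε) ≤
      2 * (((n : ℝ) - 1) * (x * ε)) + W0 n x ε + (1 + x * ε) * W0 n x ε := by
  classical
  rw [wGraph_eq]
  have hsub : (hG n).edgeFinset ⊆ Finset.univ.image (hEdge n hn2) := by
    intro e he
    rw [SimpleGraph.mem_edgeFinset] at he
    induction e with
    | _ a b =>
      rw [SimpleGraph.mem_edgeSet, hG, SimpleGraph.fromRel_adj] at he
      rw [Finset.mem_image]
      rcases he.2 with h | h
      · obtain ⟨k, hk⟩ := hRel_mem n hn2 a b h
        exact ⟨k, Finset.mem_univ _, hk⟩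
      · obtain ⟨k, hk⟩ := hRel_mem n hn2 b a h
        exact ⟨k, Finset.mem_univ _, hk.trans Sym2.eq_swap⟩
  refine (Finset.sum_le_sum_of_subset_of_nonneg hsub fun e _ _ => lift_nonneg hpos e).trans ?_
  refine (Finset.sum_image_le_of_nonneg (fun e _ => lift_nonneg hpos e)).trans ?_
  have hne : (⟨n - 1, by omega⟩ : Fin n) ≠ ⟨0, by omega⟩ := by
    intro h
    have := congrArg Fin.val h
    simp only at this
    omega
  rw [Fintype.sum_sum_type, Fintype.sum_sum_type, Fin.sum_univ_three]
  simp only [hEdge, Sym2.lift_mk, grW, if_neg hne, Finset.sum_const, Finset.card_univ,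
    Fintype.card_fin, nsmul_eq_mul]
  rw [Nat.cast_sub (by omega), Nat.cast_one]
  apply le_of_eq
  ring

lemma wGraph_lower (x ε : ℝ) (n : ℕ) (hn2 : 2 ≤ n) (hpos : ∀ a b, 0 ≤ grW n x ε a b)
    (G : SimpleGraph (GrV n))
    (h1 : ∀ i : Fin n, G.Adj (Sum.inr (Sum.inl i)) (Sum.inr (Sum.inr i)))
    (h2 : ∀ a : Fin n, a.val = n - 1 → G.Adj (Sum.inl ()) (Sum.inr (Sum.inl a))) :
    (n : ℝ) + (1 + x * ε) * W0 n x ε / 2 ≤ wGraph G (grW n x ε) (grW_symm n x ε) := by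
  classical
  rw [wGraph_eq]
  let f : Option (Fin n) → Sym2 (GrV n) := fun o => match o with
    | none => s(Sum.inl (), Sum.inr (Sum.inl ⟨n - 1, by omega⟩))
    | some i => s(Sum.inr (Sum.inl i), Sum.inr (Sum.inr i))
  have hf : Function.Injective f := by
    intro a b h
    rcases a with _ | a <;> rcases b with _ | b <;> simp [f] at h ⊢
    exact h
  have hsub : Finset.univ.image f ⊆ G.edgeFinset := by
    intro e he
    rw [Finset.mem_image] at he
    obtain ⟨o, -, rfl⟩ := he
    rw [SimpleGraph.mem_edgeFinset]
    rcases o with _ | i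
    · exact h2 _ rfl
    · exact h1 i
  refine le_trans ?_ (Finset.sum_le_sum_of_subset_of_nonneg hsub fun e _ _ => lift_nonneg hpos e)
  rw [Finset.sum_image hf.injOn, Fintype.sum_option]
  simp [f, grW]
  linarith

/-- every greedy run with stretch `t = 1 + xε` on `G(x,ε)` (i.e. processing
all edges of `G(x,ε)`, each exactly once, in some order of nondecreasing weight) outputs a
graph containing every rung `(x_i, y_i)` and not containing the edge `(x_n, y_1)`;
in particular its weight exceeds `n > 1/(2x²ε)`, and it exceeds `1/(8x²ε)` times the
minimum weight of a `(1+ε)`-spanner of `G(x,ε)`. -/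
theorem statement4 (x ε : ℝ) (hε0 : 0 < ε) (hε1 : ε < 1/4)
    (hx1 : 1 ≤ x) (hx2 : x ≤ (1/2) * Real.sqrt (1/ε))
    (n : ℕ) (hn : (n : ℤ) = 1 + ⌈1/x + 1/(2 * x^2 * ε)⌉)
    (L : List (GrV n × GrV n))
    (hnodup : (L.map fun p => s(p.1, p.2)).Nodup)
    (hcover : ∀ e : Sym2 (GrV n), e ∈ (grG n).edgeSet ↔ e ∈ L.map fun p => s(p.1, p.2))
    (hsorted : L.Pairwise fun p q => grW n x ε p.1 p.2 ≤ grW n x ε q.1 q.2) :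
    (∀ i : Fin n, (greedy (grW n x ε) (1 + x * ε) L ⊥).Adj
        (Sum.inr (Sum.inl i)) (Sum.inr (Sum.inr i))) ∧
    (∀ a b : Fin n, a.val = n - 1 → b.val = 0 →
      ¬ (greedy (grW n x ε) (1 + x * ε) L ⊥).Adj (Sum.inr (Sum.inl a)) (Sum.inr (Sum.inr b))) ∧
    (n : ℝ) < wGraph (greedy (grW n x ε) (1 + x * ε) L ⊥) (grW n x ε) (grW_symm n x ε) ∧
    1 / (2 * x^2 * ε) < (n : ℝ) ∧
    (1 / (8 * x^2 * ε)) *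
        sInf {c : ℝ | ∃ H : SimpleGraph (GrV n),
          IsSpanner (grG n) (grW n x ε) H (1 + ε) ∧ wGraph H (grW n x ε) (grW_symm n x ε) = c}
      < wGraph (greedy (grW n x ε) (1 + x * ε) L ⊥) (grW n x ε) (grW_symm n x ε) := by
  obtain ⟨hδ0, hδ1, hW0, hW1, hWx, hm, hnlt, hn2⟩ := numeric x ε hε0 hx1 hx2 n hn
  obtain ⟨hrung, hXY, hX⟩ :=
    run_facts x ε n hδ0 hδ1 hW0 hW1 hWx hm hn2 L hnodup hcover hsorted
  have htW : 0 < (1 + x * ε) * W0 n x ε / 2 := by positivity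
  have hpos : ∀ a b, 0 ≤ grW n x ε a b := by
    rintro (⟨⟩ | a | a) (⟨⟩ | b | b) <;> simp only [grW] <;> (try split_ifs) <;> linarith
  have hlow := wGraph_lower x ε n hn2 hpos _ hrung hX
  have hlt : (n : ℝ) < wGraph (greedy (grW n x ε) (1 + x * ε) L ⊥) (grW n x ε)
      (grW_symm n x ε) := by linarith
  refine ⟨hrung, hXY, hlt, hnlt, ?_⟩
  have hsp := hG_spanner x ε n hε0 hn2 hpos
  have hwt := hG_weight x ε n hn2 hpos
  have hW : W0 n x ε = 1 + ε - ((n : ℝ) - 1) * (x * ε) := rfl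
  have h4 : wGraph (hG n) (grW n x ε) (grW_symm n x ε) ≤ 4 := by nlinarith
  have hinf : sInf {c : ℝ | ∃ H : SimpleGraph (GrV n),
      IsSpanner (grG n) (grW n x ε) H (1 + ε) ∧
        wGraph H (grW n x ε) (grW_symm n x ε) = c} ≤ 4 := by
    refine le_trans (csInf_le ?_ (Set.mem_ofPred.2 ⟨hG n, hsp, rfl⟩)) h4
    refine ⟨0, ?_⟩
    rintro c ⟨H, -, rfl⟩
    classical
    rw [wGraph_eq]
    exact Finset.sum_nonneg fun e _ => lift_nonneg hpos e
  have hx0 : 0 < x := by linarith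
  have hk : 0 ≤ 1 / (8 * x^2 * ε) := by positivity
  have hfin := mul_le_mul_of_nonneg_left hinf hk
  have h84 : 1 / (8 * x^2 * ε) * 4 = 1 / (2 * x^2 * ε) := by
    field_simp
    norm_num
  linarith

end Paper
end

section
/- If the 3SAT instance I is satisfiable, then the graph G(I,ε) has a (1+ε)-spanner of total weight at most W(I,ε). -/
open scoped BigOperators

namespace Paper

variable {V : Type*}

/-- A 3SAT instance: `N` variables, `m` clauses, each clause a list of literals
`(variable, polarity)` of length 2 or 3 with pairwise distinct variables; every
variable occurs both positively and negatively. -/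
structure SatInstance where
  N : ℕ
  m : ℕ
  clause : Fin m → List (Fin N × Bool)
  two_or_three : ∀ j, (clause j).length = 2 ∨ (clause j).length = 3
  nodupVars : ∀ j, ((clause j).map Prod.fst).Nodup
  posOcc : ∀ i : Fin N, ∃ j, (i, true) ∈ clause j
  negOcc : ∀ i : Fin N, ∃ j, (i, false) ∈ clause j

/-- Satisfiability of a 3SAT instance. -/
def SatInstance.Satisfiable (I : SatInstance) : Prop :=
  ∃ a : Fin I.N → Bool, ∀ j, ∃ p ∈ I.clause j, a p.1 = p.2

/-- The number of clauses containing the literal `(i, pol)`,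
i.e. `|C_i⁺|` for `pol = true` and `|C_i⁻|` for `pol = false`. -/
def SatInstance.occ (I : SatInstance) (i : Fin I.N) (pol : Bool) : ℕ :=
  (Finset.univ.filter fun j : Fin I.m => (i, pol) ∈ I.clause j).card

/-- `h_i = max(|C_i⁺|, |C_i⁻|)`. -/
def SatInstance.h (I : SatInstance) (i : Fin I.N) : ℕ :=
  max (I.occ i true) (I.occ i false)

/-- Vertices of the graph `G(I,ε)`.  For clause `j`: `e j`, `f j` and `l j h`, `r j h`
for each literal position `h`.  For variable `i` and polarity `pol` (`pol = true` is the
positive path of true edges, `pol = false` the negative path of false edges):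
`s i`, `t i`, the endpoints `a i pol k`, `b i pol k` of the `k`-th true/false edge,
the apex `g i pol k`, and the terminal edge endpoints `u i pol`, `u' i pol`
(so `u i true = u_i`, `u' i true = u_i'`, `u i false = v_i`, `u' i false = v_i'`). -/
inductive GVert (I : SatInstance) : Type
  | e (j : Fin I.m)
  | f (j : Fin I.m)
  | l (j : Fin I.m) (h : Fin (I.clause j).length)
  | r (j : Fin I.m) (h : Fin (I.clause j).length)
  | s (i : Fin I.N)
  | t (i : Fin I.N)
  | a (i : Fin I.N) (pol : Bool) (k : Fin (I.h i))
  | b (i : Fin I.N) (pol : Bool) (k : Fin (I.h i))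
  | g (i : Fin I.N) (pol : Bool) (k : Fin (I.h i))
  | u (i : Fin I.N) (pol : Bool)
  | u' (i : Fin I.N) (pol : Bool)

/-- The weighted edges of `G(I,ε)` in a canonical direction: `ew I ε asgn x y = some c`
iff `(x,y)` is an edge of weight `c`.  Here `asgn j h` is the index of the true/false
edge in the gadget of the underlying variable of the `h`-th literal of clause `j`
associated with clause `j`. -/
noncomputable def ew (I : SatInstance) (ε : ℝ)
    (asgn : (j : Fin I.m) → Fin (I.clause j).length → ℕ) :
    GVert I → GVert I → Option ℝ
  -- clause gadget
  | .e j, .l j' h => if j = j' ∧ h.val = 0 then some 0 else none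
  | .r j h, .l j' h' => if j = j' ∧ h'.val = h.val + 1 then some 0 else none
  | .r j h, .f j' => if j = j' ∧ h.val + 1 = (I.clause j).length then some 0 else none
  | .l j h, .r j' h' => if j = j' ∧ h.val = h'.val then some (2 + 2 * ε) else none
  | .e j, .f j' =>
      if j = j' then
        some (if (I.clause j).length = 3 then (6 + 10 * ε) / (1 + ε)
              else (4 + 6 * ε) / (1 + ε))
      else none
  -- variable gadget
  | .s i, .a i' _ k => if i = i' ∧ k.val = 0 then some 0 else none
  | .b i pol k, .a i' pol' k' =>
      if i = i' ∧ pol = pol' ∧ k'.val = k.val + 1 then some 0 else none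
  | .a i pol k, .b i' pol' k' =>
      if i = i' ∧ pol = pol' ∧ k.val = k'.val then some 2 else none
  | .a i pol k, .g i' pol' k' =>
      if i = i' ∧ pol = pol' ∧ k.val = k'.val then some (1 + ε) else none
  | .b i pol k, .g i' pol' k' =>
      if i = i' ∧ pol = pol' ∧ k.val = k'.val then some (1 + ε) else none
  | .b i pol k, .u i' pol' =>
      if i = i' ∧ pol = pol' ∧ k.val + 1 = I.h i then some 0 else none
  | .u i pol, .u' i' pol' => if i = i' ∧ pol = pol' then some (2 * (I.h i : ℝ)) else none
  | .u' i _, .t i' => if i = i' then some 0 else none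
  | .s i, .t i' => if i = i' then some (4 * (I.h i : ℝ) / (1 + ε)) else none
  -- connection edges
  | .l j h, .a i pol k =>
      if (I.clause j).get h = (i, pol) ∧ k.val = asgn j h then some ε else none
  | .r j h, .b i pol k =>
      if (I.clause j).get h = (i, pol) ∧ k.val = asgn j h then some ε else none
  | _, _ => none

/-- The (symmetric) weight function of `G(I,ε)`. -/
noncomputable def satW (I : SatInstance) (ε : ℝ)
    (asgn : (j : Fin I.m) → Fin (I.clause j).length → ℕ) (x y : GVert I) : ℝ :=
  max ((ew I ε asgn x y).getD 0) ((ew I ε asgn y x).getD 0)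

lemma satW_symm (I : SatInstance) (ε : ℝ)
    (asgn : (j : Fin I.m) → Fin (I.clause j).length → ℕ) :
    ∀ x y : GVert I, satW I ε asgn x y = satW I ε asgn y x :=
  fun _ _ => max_comm _ _

/-- The graph `G(I,ε)`. -/
noncomputable def satG (I : SatInstance) (ε : ℝ)
    (asgn : (j : Fin I.m) → Fin (I.clause j).length → ℕ) : SimpleGraph (GVert I) :=
  SimpleGraph.fromRel fun x y => (ew I ε asgn x y).isSome

/-- `W(I,ε) = 2ε·Σ_j |c_j| + 2(5+2ε)·Σ_i h_i`. -/
noncomputable def Wtot (I : SatInstance) (ε : ℝ) : ℝ :=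
  2 * ε * (∑ j : Fin I.m, ((I.clause j).length : ℝ)) +
    2 * (5 + 2 * ε) * (∑ i : Fin I.N, (I.h i : ℝ))

/-- Validity of the association `asgn` of clauses to true/false edges: the associated
index is a valid index in the variable gadget, and distinct occurrences of the same
literal are associated with distinct true/false edges. -/
def ValidAsgn (I : SatInstance)
    (asgn : (j : Fin I.m) → Fin (I.clause j).length → ℕ) : Prop :=
  (∀ (j : Fin I.m) (h : Fin (I.clause j).length), asgn j h < I.h ((I.clause j).get h).1) ∧
  (∀ (j : Fin I.m) (h : Fin (I.clause j).length)
      (j' : Fin I.m) (h' : Fin (I.clause j').length),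
    (I.clause j).get h = (I.clause j').get h' → (j ≠ j' ∨ (h : ℕ) ≠ (h' : ℕ)) →
    asgn j h ≠ asgn j' h')

/-- Edges of `G(I,ε)` left out of the spanner for the assignment `α`. -/
def Rem (I : SatInstance) (α : Fin I.N → Bool) : GVert I → GVert I → Prop
  | .l _ _, .r _ _ => True
  | .e _, .f _ => True
  | .s _, .t _ => True
  | .a i pol _, .b _ _ _ => α i ≠ pol
  | _, _ => False

/-- The spanner. -/
def Hs (I : SatInstance) (ε : ℝ) (asgn : (j : Fin I.m) → Fin (I.clause j).length → ℕ)
    (α : Fin I.N → Bool) : SimpleGraph (GVert I) :=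
  SimpleGraph.fromRel fun x y => (ew I ε asgn x y).isSome ∧ ¬ Rem I α x y

/-- There is a walk of weight at most `c`. -/
def Dle (G : SimpleGraph V) (w : V → V → ℝ) (x y : V) (c : ℝ) : Prop :=
  ∃ p : G.Walk x y, wWalk w p ≤ c

lemma Dle.mono {G : SimpleGraph V} {w : V → V → ℝ} {x y : V} {c d : ℝ}
    (h : Dle G w x y c) (hcd : c ≤ d) : Dle G w x y d := by
  obtain ⟨p, hp⟩ := h
  exact ⟨p, hp.trans hcd⟩

lemma Dle.trans {G : SimpleGraph V} {w : V → V → ℝ} {x y z : V} {c d : ℝ}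
    (h : Dle G w x y c) (h' : Dle G w y z d) : Dle G w x z (c + d) := by
  obtain ⟨p, hp⟩ := h
  obtain ⟨q, hq⟩ := h'
  refine ⟨p.append q, ?_⟩
  simp only [wWalk, SimpleGraph.Walk.darts_append, List.map_append, List.sum_append] at *
  linarith

lemma Dle.edge {G : SimpleGraph V} {w : V → V → ℝ} {x y : V} (h : G.Adj x y) :
    Dle G w x y (w x y) :=
  ⟨.cons h .nil, by simp [wWalk]⟩

lemma Dle.symm {G : SimpleGraph V} {w : V → V → ℝ} (hw : ∀ a b, w a b = w b a)
    {x y : V} {c : ℝ} (h : Dle G w x y c) : Dle G w y x c := by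
  obtain ⟨p, hp⟩ := h
  refine ⟨p.reverse, le_of_eq_of_le ?_ hp⟩
  simp only [wWalk, SimpleGraph.Walk.darts_reverse, List.map_reverse, List.sum_reverse,
    List.map_map]
  congr 1
  apply List.map_congr_left
  intro d _
  exact hw _ _

lemma isSpanner_of_edges {G H : SimpleGraph V} {w : V → V → ℝ} {t : ℝ} (ht : 0 < t)
    (hle : H ≤ G) (h : ∀ x y, G.Adj x y → Dle H w x y (t * w x y)) : IsSpanner G w H t := by
  refine ⟨hle, fun x y => ?_⟩
  have key : ∀ {x y} (p : G.Walk x y), Dle H w x y (t * wWalk w p) := by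
    intro x y p
    induction p with
    | nil => exact ⟨.nil, by simp [wWalk]⟩
    | cons hadj p ih =>
      refine ((h _ _ hadj).trans ih).mono ?_
      simp [wWalk, mul_add]
  have ht' : (0 : EReal) < (t : EReal) := by exact_mod_cast ht
  rw [← EReal.div_le_iff_le_mul ht' (EReal.coe_ne_top t)]
  unfold gdist
  refine le_iInf fun p => ?_
  rw [EReal.div_le_iff_le_mul ht' (EReal.coe_ne_top t)]
  obtain ⟨q, hq⟩ := key p
  refine (iInf_le _ q).trans ?_
  rw [← EReal.coe_mul]
  exact_mod_cast hq

lemma ew_anti (I : SatInstance) (ε : ℝ)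
    (asgn : (j : Fin I.m) → Fin (I.clause j).length → ℕ) (x y : GVert I) (c : ℝ)
    (h : ew I ε asgn x y = some c) : ew I ε asgn y x = none := by
  cases x <;> cases y <;> simp [ew] at h ⊢ <;> grind

lemma ew_nonneg (I : SatInstance) (ε : ℝ) (hε0 : 0 < ε)
    (asgn : (j : Fin I.m) → Fin (I.clause j).length → ℕ) (x y : GVert I) (c : ℝ)
    (h : ew I ε asgn x y = some c) : 0 ≤ c := by
  cases x <;> cases y <;> simp [ew] at h <;> obtain ⟨h1, rfl⟩ := h <;> (try split_ifs) <;>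
    positivity

lemma satW_eq (I : SatInstance) (ε : ℝ) (hε0 : 0 < ε)
    (asgn : (j : Fin I.m) → Fin (I.clause j).length → ℕ) (x y : GVert I) (c : ℝ)
    (h : ew I ε asgn x y = some c) : satW I ε asgn x y = c := by
  simp [satW, h, ew_anti I ε asgn x y c h, ew_nonneg I ε hε0 asgn x y c h]

lemma ew_ne (I : SatInstance) (ε : ℝ)
    (asgn : (j : Fin I.m) → Fin (I.clause j).length → ℕ) (x y : GVert I) (c : ℝ)
    (h : ew I ε asgn x y = some c) : x ≠ y := by
  rintro rfl
  have := ew_anti I ε asgn x x c h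
  simp_all

section
variable (I : SatInstance) (ε : ℝ) (hε0 : 0 < ε)
    (asgn : (j : Fin I.m) → Fin (I.clause j).length → ℕ) (α : Fin I.N → Bool)

lemma keep (hε0 : 0 < ε) (x y : GVert I) (c : ℝ) (h : ew I ε asgn x y = some c)
    (hr : ¬ Rem I α x y) : Dle (Hs I ε asgn α) (satW I ε asgn) x y c := by
  rw [← satW_eq I ε hε0 asgn x y c h]
  apply Dle.edge
  rw [Hs, SimpleGraph.fromRel_adj]
  exact ⟨ew_ne I ε asgn x y c h, Or.inl ⟨by simp [h], hr⟩⟩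

lemma d_ab_true (hε0 : 0 < ε) (i : Fin I.N) (k : Fin (I.h i)) :
    Dle (Hs I ε asgn α) (satW I ε asgn) (.a i (α i) k) (.b i (α i) k) 2 :=
  keep I ε asgn α hε0 _ _ _ (by simp [ew]) (by simp [Rem])

lemma d_ab (hε0 : 0 < ε) (i : Fin I.N) (pol : Bool) (k : Fin (I.h i)) :
    Dle (Hs I ε asgn α) (satW I ε asgn) (.a i pol k) (.b i pol k) (2 + 2 * ε) := by
  have h1 := keep I ε asgn α hε0 (.a i pol k) (.g i pol k) (1 + ε) (by simp [ew]) (by simp [Rem])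
  have h2 := keep I ε asgn α hε0 (.b i pol k) (.g i pol k) (1 + ε) (by simp [ew]) (by simp [Rem])
  exact (h1.trans (h2.symm (satW_symm I ε asgn))).mono (by linarith)

lemma d_lr (hε0 : 0 < ε) (hasgn : ValidAsgn I asgn) (j : Fin I.m)
    (h : Fin (I.clause j).length) :
    Dle (Hs I ε asgn α) (satW I ε asgn) (.l j h) (.r j h)
      (2 + 4 * ε - if α ((I.clause j).get h).1 = ((I.clause j).get h).2 then 2 * ε else 0) := by
  rcases hp : (I.clause j).get h with ⟨i, pol⟩
  have hk := hasgn.1 j h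
  rw [hp] at hk
  have h1 := keep I ε asgn α hε0 (.l j h) (.a i pol ⟨asgn j h, hk⟩) ε
    (by simp only [ew]; rw [if_pos ⟨hp, trivial⟩]) (by simp [Rem])
  have h2 := (keep I ε asgn α hε0 (.r j h) (.b i pol ⟨asgn j h, hk⟩) ε
    (by simp only [ew]; rw [if_pos ⟨hp, trivial⟩]) (by simp [Rem])).symm (satW_symm I ε asgn)
  split_ifs with hc
  · simp only at hc
    subst hc
    exact ((h1.trans (d_ab_true I ε asgn α hε0 i _)).trans h2).mono (by linarith)
  · exact ((h1.trans (d_ab I ε asgn α hε0 i pol _)).trans h2).mono (by linarith)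

lemma d_er (hε0 : 0 < ε) (hasgn : ValidAsgn I asgn) (j : Fin I.m)
    (h0 : Fin (I.clause j).length)
    (ht : α ((I.clause j).get h0).1 = ((I.clause j).get h0).2) (n : ℕ)
    (hn : n < (I.clause j).length) :
    Dle (Hs I ε asgn α) (satW I ε asgn) (.e j) (.r j ⟨n, hn⟩)
      ((n + 1) * (2 + 4 * ε) - if h0.val ≤ n then 2 * ε else 0) := by
  induction n with
  | zero =>
    have h1 := keep I ε asgn α hε0 (.e j) (.l j ⟨0, hn⟩) 0 (by simp [ew]) (by simp [Rem])
    refine (h1.trans (d_lr I ε asgn α hε0 hasgn j ⟨0, hn⟩)).mono ?_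
    by_cases hh : h0.val ≤ 0
    · obtain rfl : h0 = ⟨0, hn⟩ := Fin.ext (by simpa using hh)
      rw [if_pos ht, if_pos hh]; push_cast; linarith
    · rw [if_neg hh]; push_cast; split_ifs <;> linarith
  | succ n ih =>
    have h1 := keep I ε asgn α hε0 (.r j ⟨n, by omega⟩) (.l j ⟨n + 1, hn⟩) 0
      (by simp [ew]) (by simp [Rem])
    refine (((ih (by omega)).trans h1).trans (d_lr I ε asgn α hε0 hasgn j ⟨n + 1, hn⟩)).mono ?_
    by_cases hh : h0.val = n + 1
    · obtain rfl : h0 = ⟨n + 1, hn⟩ := Fin.ext hh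
      rw [if_pos ht, if_pos le_rfl, if_neg (by simp)]; push_cast; linarith
    · by_cases hl : h0.val ≤ n
      · rw [if_pos hl, if_pos (show h0.val ≤ n + 1 by omega)]; push_cast; split_ifs <;> linarith
      · rw [if_neg hl, if_neg (show ¬ h0.val ≤ n + 1 by omega)]; push_cast; split_ifs <;> linarith

lemma d_ef (hε0 : 0 < ε) (hasgn : ValidAsgn I asgn) (j : Fin I.m)
    (hsat : ∃ p ∈ I.clause j, α p.1 = p.2) :
    Dle (Hs I ε asgn α) (satW I ε asgn) (.e j) (.f j)
      ((I.clause j).length * (2 + 4 * ε) - 2 * ε) := by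
  obtain ⟨p, hp, ht⟩ := hsat
  obtain ⟨h0, rfl⟩ := List.get_of_mem hp
  have hlt := h0.isLt
  have h1 := d_er I ε asgn α hε0 hasgn j h0 ht ((I.clause j).length - 1) (by omega)
  have h2 := keep I ε asgn α hε0 (.r j ⟨(I.clause j).length - 1, by omega⟩) (.f j) 0
    (by simp only [ew]; rw [if_pos ⟨trivial, by omega⟩]) (by simp [Rem])
  refine (h1.trans h2).mono ?_
  rw [if_pos (by omega)]
  have : (((I.clause j).length - 1 : ℕ) : ℝ) + 1 = (I.clause j).length := by
    have : (I.clause j).length - 1 + 1 = (I.clause j).length := by omega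
    exact_mod_cast this
  rw [this]; linarith

lemma d_sb (hε0 : 0 < ε) (i : Fin I.N) (n : ℕ) (hn : n < I.h i) :
    Dle (Hs I ε asgn α) (satW I ε asgn) (.s i) (.b i (α i) ⟨n, hn⟩) (2 * (n + 1)) := by
  induction n with
  | zero =>
    have h1 := keep I ε asgn α hε0 (.s i) (.a i (α i) ⟨0, hn⟩) 0 (by simp [ew]) (by simp [Rem])
    exact (h1.trans (d_ab_true I ε asgn α hε0 i _)).mono (by simp)
  | succ n ih =>
    have h1 := keep I ε asgn α hε0 (.b i (α i) ⟨n, by omega⟩) (.a i (α i) ⟨n + 1, hn⟩) 0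
      (by simp [ew]) (by simp [Rem])
    exact (((ih (by omega)).trans h1).trans (d_ab_true I ε asgn α hε0 i _)).mono
      (by push_cast; linarith)

lemma h_pos (i : Fin I.N) : 0 < I.h i := by
  obtain ⟨j, hj⟩ := I.posOcc i
  refine lt_of_lt_of_le ?_ (le_max_left _ _)
  exact Finset.card_pos.2 ⟨j, by simpa using hj⟩

lemma d_st (hε0 : 0 < ε) (i : Fin I.N) :
    Dle (Hs I ε asgn α) (satW I ε asgn) (.s i) (.t i) (4 * (I.h i : ℝ)) := by
  have hp := h_pos I i
  have h1 := d_sb I ε asgn α hε0 i (I.h i - 1) (by omega)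
  have h2 := keep I ε asgn α hε0 (.b i (α i) ⟨I.h i - 1, by omega⟩) (.u i (α i)) 0
    (by simp only [ew]; rw [if_pos ⟨trivial, trivial, by omega⟩]) (by simp [Rem])
  have h3 := keep I ε asgn α hε0 (.u i (α i)) (.u' i (α i)) (2 * (I.h i : ℝ))
    (by simp [ew]) (by simp [Rem])
  have h4 := keep I ε asgn α hε0 (.u' i (α i)) (.t i) 0 (by simp [ew]) (by simp [Rem])
  refine (((h1.trans h2).trans h3).trans h4).mono ?_
  have : ((I.h i - 1 : ℕ) : ℝ) + 1 = I.h i := by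
    have : I.h i - 1 + 1 = I.h i := by omega
    exact_mod_cast this
  rw [this]; linarith

lemma edge_spanned (hε0 : 0 < ε) (hasgn : ValidAsgn I asgn)
    (hsat : ∀ j, ∃ p ∈ I.clause j, α p.1 = p.2) (x y : GVert I) (c : ℝ)
    (h : ew I ε asgn x y = some c) :
    Dle (Hs I ε asgn α) (satW I ε asgn) x y ((1 + ε) * c) := by
  by_cases hr : Rem I α x y
  · have hne : (1 + ε) ≠ 0 := by positivity
    cases x <;> cases y <;> simp only [Rem] at hr
    case e.f j j' =>
      simp only [ew, Option.ite_none_right_eq_some, Option.some.injEq] at h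
      obtain ⟨rfl, rfl⟩ := h
      refine (d_ef I ε asgn α hε0 hasgn j (hsat j)).mono ?_
      rcases I.two_or_three j with h2 | h2 <;> rw [h2] <;> norm_num <;>
        rw [mul_div_cancel₀ _ hne] <;> linarith
    case l.r j h1 j' h2 =>
      simp only [ew, Option.ite_none_right_eq_some, Option.some.injEq] at h
      obtain ⟨⟨rfl, h3⟩, rfl⟩ := h
      obtain rfl := Fin.ext h3
      refine (d_lr I ε asgn α hε0 hasgn j h1).mono ?_
      split_ifs <;> nlinarith
    case s.t i i' =>
      simp only [ew, Option.ite_none_right_eq_some, Option.some.injEq] at h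
      obtain ⟨rfl, rfl⟩ := h
      refine (d_st I ε asgn α hε0 i).mono ?_
      rw [mul_div_cancel₀ _ hne]
    case a.b i pol k i' pol' k' =>
      simp only [ew, Option.ite_none_right_eq_some, Option.some.injEq] at h
      obtain ⟨⟨rfl, rfl, h3⟩, rfl⟩ := h
      obtain rfl := Fin.ext h3
      exact (d_ab I ε asgn α hε0 i pol k).mono (by linarith)
  · refine (keep I ε asgn α hε0 x y c h hr).mono ?_
    have := ew_nonneg I ε hε0 asgn x y c h
    nlinarith

/-- Index type of the positive-weight spanner edges. -/
abbrev Idx (I : SatInstance) : Type :=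
  ((((j : Fin I.m) × Fin (I.clause j).length) × Bool) ⊕
    (((i : Fin I.N) × Fin (I.h i)) × Bool × Bool)) ⊕
  (((i : Fin I.N) × Fin (I.h i)) ⊕ (Fin I.N × Bool))

/-- The positive-weight spanner edges. -/
def Fe (I : SatInstance) (asgn : (j : Fin I.m) → Fin (I.clause j).length → ℕ)
    (hasgn : ValidAsgn I asgn) (α : Fin I.N → Bool) : Idx I → GVert I × GVert I
  | .inl (.inl (⟨j, h⟩, true)) => (.l j h, .a ((I.clause j).get h).1 ((I.clause j).get h).2
      ⟨asgn j h, hasgn.1 j h⟩)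
  | .inl (.inl (⟨j, h⟩, false)) => (.r j h, .b ((I.clause j).get h).1 ((I.clause j).get h).2
      ⟨asgn j h, hasgn.1 j h⟩)
  | .inl (.inr (⟨i, k⟩, pol, true)) => (.a i pol k, .g i pol k)
  | .inl (.inr (⟨i, k⟩, pol, false)) => (.b i pol k, .g i pol k)
  | .inr (.inl ⟨i, k⟩) => (.a i (α i) k, .b i (α i) k)
  | .inr (.inr (i, pol)) => (.u i pol, .u' i pol)

/-- Their weights. -/
noncomputable def Fw (I : SatInstance) (ε : ℝ) : Idx I → ℝ
  | .inl (.inl _) => ε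
  | .inl (.inr _) => 1 + ε
  | .inr (.inl _) => 2
  | .inr (.inr (i, _)) => 2 * (I.h i : ℝ)

lemma ew_Fe (hasgn : ValidAsgn I asgn) (τ : Idx I) :
    ew I ε asgn (Fe I asgn hasgn α τ).1 (Fe I asgn hasgn α τ).2 = some (Fw I ε τ) := by
  rcases τ with (⟨⟨j, h⟩, b⟩ | ⟨⟨i, k⟩, pol, b⟩) | (⟨i, k⟩ | ⟨i, pol⟩)
  · cases b <;> simp [Fe, Fw, ew]
  · cases b <;> simp [Fe, Fw, ew]
  · simp [Fe, Fw, ew]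
  · simp [Fe, Fw, ew]

lemma cover (hasgn : ValidAsgn I asgn) (x y : GVert I) (c : ℝ)
    (h : ew I ε asgn x y = some c) (hr : ¬ Rem I α x y) (hc : c ≠ 0) :
    ∃ τ, Fe I asgn hasgn α τ = (x, y) := by
  cases x <;> cases y <;> simp only [ew, Option.ite_none_right_eq_some, Option.some.injEq,
    reduceCtorEq] at h <;> simp only [Rem, not_true_eq_false, not_not] at hr <;>
    obtain ⟨h1, rfl⟩ := h <;> try exact absurd rfl hc
  case l.a j h i pol k =>
    obtain ⟨h1, h2⟩ := h1
    refine ⟨.inl (.inl (⟨j, h⟩, true)), ?_⟩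
    obtain rfl : i = ((I.clause j).get h).1 := by rw [h1]
    obtain rfl : pol = ((I.clause j).get h).2 := by rw [h1]
    obtain rfl : k = ⟨asgn j h, hasgn.1 j h⟩ := Fin.ext h2
    rfl
  case r.b j h i pol k =>
    obtain ⟨h1, h2⟩ := h1
    refine ⟨.inl (.inl (⟨j, h⟩, false)), ?_⟩
    obtain rfl : i = ((I.clause j).get h).1 := by rw [h1]
    obtain rfl : pol = ((I.clause j).get h).2 := by rw [h1]
    obtain rfl : k = ⟨asgn j h, hasgn.1 j h⟩ := Fin.ext h2
    rfl
  case a.b i pol k i' pol' k' =>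
    obtain ⟨rfl, rfl, h3⟩ := h1
    obtain rfl := Fin.ext h3
    subst hr
    exact ⟨.inr (.inl ⟨i, k⟩), rfl⟩
  case a.g i pol k i' pol' k' =>
    obtain ⟨rfl, rfl, h3⟩ := h1
    obtain rfl := Fin.ext h3
    exact ⟨.inl (.inr (⟨i, k⟩, pol, true)), rfl⟩
  case b.g i pol k i' pol' k' =>
    obtain ⟨rfl, rfl, h3⟩ := h1
    obtain rfl := Fin.ext h3
    exact ⟨.inl (.inr (⟨i, k⟩, pol, false)), rfl⟩
  case u.u' i pol i' pol' =>
    obtain ⟨rfl, rfl⟩ := h1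
    exact ⟨.inr (.inr (i, pol)), rfl⟩

lemma sum_Fw : ∑ τ : Idx I, Fw I ε τ = Wtot I ε := by
  simp only [Fintype.sum_sum_type, Fw, Fintype.sum_prod_type, Wtot,
    Finset.sum_const, Finset.card_univ, Fintype.card_bool, Fintype.card_fin, nsmul_eq_mul,
    Fintype.card_sigma, Fintype.card_prod, ← Finset.mul_sum]
  push_cast
  ring

lemma wGraph_le {T : Type*} [Fintype T] (G : SimpleGraph V) (w : V → V → ℝ)
    (hw : ∀ a b, w a b = w b a) (hw0 : ∀ a b, 0 ≤ w a b) (F : T → V × V)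
    (hF : ∀ x y, G.Adj x y → w x y ≠ 0 → ∃ τ, s((F τ).1, (F τ).2) = s(x, y)) :
    wGraph G w hw ≤ ∑ τ, w (F τ).1 (F τ).2 := by
  classical
  set L : Sym2 V → ℝ := Sym2.lift ⟨w, hw⟩ with hL
  have hL0 : ∀ e, 0 ≤ L e := fun e => by
    induction e using Sym2.ind with | _ x y => exact hw0 x y
  set S : Finset (Sym2 V) := Finset.univ.image fun τ => s((F τ).1, (F τ).2) with hS
  have e1 : wGraph G w hw = ∑ᶠ e, G.edgeSet.indicator L e := by
    rw [wGraph, finsum_mem_def]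
  rw [e1, finsum_eq_sum_of_support_subset (s := S)]
  · calc ∑ e ∈ S, G.edgeSet.indicator L e ≤ ∑ e ∈ S, L e :=
          Finset.sum_le_sum fun e _ => Set.indicator_le_self' (fun _ _ => hL0 _) e
      _ ≤ ∑ τ, L s((F τ).1, (F τ).2) :=
          Finset.sum_image_le_of_nonneg (fun _ _ => hL0 _)
      _ = _ := rfl
  · intro e he
    induction e using Sym2.ind with | _ x y =>
    rw [Function.mem_support, Set.indicator_apply_ne_zero] at he
    obtain ⟨h1, h2⟩ := he
    obtain ⟨τ, hτ⟩ := hF x y h1 h2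
    simp only [hS, Finset.coe_image, Finset.coe_univ, Set.image_univ, Set.mem_range]
    exact ⟨τ, hτ⟩

lemma satW_nonneg (hε0 : 0 < ε) (x y : GVert I) : 0 ≤ satW I ε asgn x y := by
  refine le_trans ?_ (le_max_left _ _)
  cases h : ew I ε asgn x y with
  | none => simp
  | some c => simpa using ew_nonneg I ε hε0 asgn x y c h

end

/-- if `I` is satisfiable then `G(I,ε)` has a `(1+ε)`-spanner of total
weight at most `W(I,ε)`. -/
theorem statement14 (I : SatInstance) (ε : ℝ) (hε0 : 0 < ε) (hε1 : ε < 1)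
    (asgn : (j : Fin I.m) → Fin (I.clause j).length → ℕ) (hasgn : ValidAsgn I asgn)
    (hsat : I.Satisfiable) :
    ∃ H : SimpleGraph (GVert I), IsSpanner (satG I ε asgn) (satW I ε asgn) H (1 + ε) ∧
      wGraph H (satW I ε asgn) (satW_symm I ε asgn) ≤ Wtot I ε := by
  obtain ⟨α, hα⟩ := hsat
  refine ⟨Hs I ε asgn α, isSpanner_of_edges (by linarith) ?_ ?_, ?_⟩
  · intro x y hxy
    rw [Hs, SimpleGraph.fromRel_adj] at hxy
    rw [satG, SimpleGraph.fromRel_adj]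
    exact ⟨hxy.1, hxy.2.imp And.left And.left⟩
  · intro x y hxy
    rw [satG, SimpleGraph.fromRel_adj] at hxy
    rcases hxy.2 with h | h <;> obtain ⟨c, hc⟩ := Option.isSome_iff_exists.1 h
    · rw [satW_eq I ε hε0 asgn x y c hc]
      exact edge_spanned I ε asgn α hε0 hasgn hα x y c hc
    · rw [satW_symm, satW_eq I ε hε0 asgn y x c hc]
      exact (edge_spanned I ε asgn α hε0 hasgn hα y x c hc).symm (satW_symm I ε asgn)
  · rw [← sum_Fw]
    refine (wGraph_le _ _ _ (satW_nonneg I ε asgn hε0) (Fe I asgn hasgn α) ?_).trans_eq ?_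
    · intro x y hxy hw
      rw [Hs, SimpleGraph.fromRel_adj] at hxy
      rcases hxy.2 with h | h <;> obtain ⟨c, hc⟩ := Option.isSome_iff_exists.1 h.1
      · rw [satW_eq I ε hε0 asgn x y c hc] at hw
        obtain ⟨τ, hτ⟩ := cover I ε asgn α hasgn x y c hc h.2 hw
        exact ⟨τ, by rw [hτ]⟩
      · rw [satW_symm, satW_eq I ε hε0 asgn y x c hc] at hw
        obtain ⟨τ, hτ⟩ := cover I ε asgn α hasgn y x c hc h.2 hw
        exact ⟨τ, by rw [hτ]; exact Sym2.eq_swap⟩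
    · exact Finset.sum_congr rfl fun τ _ => satW_eq I ε hε0 asgn _ _ _ (ew_Fe I ε asgn α hasgn τ)

end Paper
end
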